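/- For each triple (a,b,c) ∈ {(5,2,1), (4,3,1), (2,2,2)}, there exists a type-1 configuration of [a,b,c] whose contact graph admits no proper 5-coloring. -/

import Mathlib

/-- A cuboid with integer root and integer dimensions. -/
structure Cuboid where
  root : ℤ × ℤ × ℤ
  dims : ℤ × ℤ × ℤ
deriving DecidableEq

namespace Cuboid

/-- The dimensions are positive. -/
def valid (C : Cuboid) : Prop :=
  0 < C.dims.1 ∧ 0 < C.dims.2.1 ∧ 0 < C.dims.2.2

/-- The closed cuboid `[x,x+a] × [y,y+b] × [z,z+c] ⊆ ℝ³`. -/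
def toSet (C : Cuboid) : Set (ℝ × ℝ × ℝ) :=
  {p | (C.root.1 : ℝ) ≤ p.1 ∧ p.1 ≤ C.root.1 + C.dims.1 ∧
       (C.root.2.1 : ℝ) ≤ p.2.1 ∧ p.2.1 ≤ C.root.2.1 + C.dims.2.1 ∧
       (C.root.2.2 : ℝ) ≤ p.2.2 ∧ p.2.2 ≤ C.root.2.2 + C.dims.2.2}

/-- The open cuboid `(x,x+a) × (y,y+b) × (z,z+c) ⊆ ℝ³` (the interior). -/
def inte (C : Cuboid) : Set (ℝ × ℝ × ℝ) :=
  {p | (C.root.1 : ℝ) < p.1 ∧ p.1 < C.root.1 + C.dims.1 ∧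
       (C.root.2.1 : ℝ) < p.2.1 ∧ p.2.1 < C.root.2.1 + C.dims.2.1 ∧
       (C.root.2.2 : ℝ) < p.2.2 ∧ p.2.2 < C.root.2.2 + C.dims.2.2}

/-- The set `(ℤ×ℤ×ℝ) ∪ (ℤ×ℝ×ℤ) ∪ (ℝ×ℤ×ℤ)` of grid lines. -/
def grid : Set (ℝ × ℝ × ℝ) :=
  {p | ((∃ m : ℤ, p.1 = m) ∧ (∃ n : ℤ, p.2.1 = n)) ∨
       ((∃ m : ℤ, p.1 = m) ∧ (∃ n : ℤ, p.2.2 = n)) ∨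
       ((∃ m : ℤ, p.2.1 = m) ∧ (∃ n : ℤ, p.2.2 = n))}

/-- Two cuboids collide when their interiors intersect. -/
def Collide (C D : Cuboid) : Prop := (C.inte ∩ D.inte).Nonempty

/-- Two cuboids touch when their interiors are disjoint but their intersection
contains a point outside the grid lines (i.e. it is a non-degenerate rectangle). -/
def Touch (C D : Cuboid) : Prop :=
  ¬ Collide C D ∧ ∃ p ∈ C.toSet ∩ D.toSet, p ∉ grid

end Cuboid

/-- A configuration: a finite family of valid pairwise non-colliding cuboids. -/
def IsConfig (F : Finset Cuboid) : Prop :=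
  (∀ C ∈ F, C.valid) ∧ ∀ C ∈ F, ∀ D ∈ F, C ≠ D → ¬ Cuboid.Collide C D

/-- A type-1 configuration of `[a,b,c]`: every cuboid has dimensions exactly `(a,b,c)`. -/
def Type1 (a b c : ℕ) (F : Finset Cuboid) : Prop :=
  ∀ C ∈ F, C.dims = ((a : ℤ), (b : ℤ), (c : ℤ))

/-- A type-2 configuration of `[a,b,c]`: every cuboid has dimensions `(a,b,c)` or `(b,a,c)`. -/
def Type2 (a b c : ℕ) (F : Finset Cuboid) : Prop :=
  ∀ C ∈ F, C.dims = ((a : ℤ), (b : ℤ), (c : ℤ)) ∨ C.dims = ((b : ℤ), (a : ℤ), (c : ℤ))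

/-- A type-3 configuration of `[a,b,c]`: every cuboid's dimensions are a permutation of `(a,b,c)`. -/
def Type3 (a b c : ℕ) (F : Finset Cuboid) : Prop :=
  ∀ C ∈ F, C.dims = ((a : ℤ), (b : ℤ), (c : ℤ)) ∨ C.dims = ((a : ℤ), (c : ℤ), (b : ℤ)) ∨
    C.dims = ((b : ℤ), (a : ℤ), (c : ℤ)) ∨ C.dims = ((b : ℤ), (c : ℤ), (a : ℤ)) ∨
    C.dims = ((c : ℤ), (a : ℤ), (b : ℤ)) ∨ C.dims = ((c : ℤ), (b : ℤ), (a : ℤ))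

/-- A proper `k`-coloring of a configuration: touching cuboids get distinct colors. -/
def ProperColoring (k : ℕ) (F : Finset Cuboid) : Prop :=
  ∃ κ : Cuboid → Fin k, ∀ C ∈ F, ∀ D ∈ F, Cuboid.Touch C D → κ C ≠ κ D

/-! ### Integer criteria for separation and contact -/

/-- The intervals `[s, s + a]` and `[t, t + a]` share an endpoint but no interior point. -/
def Abut (a s t : ℤ) : Prop := s + a = t ∨ t + a = s

/-- The intervals `(s, s + a)` and `(t, t + a)` intersect. -/
def Overlap (a s t : ℤ) : Prop := s < t + a ∧ t < s + a

instance (a s t : ℤ) : Decidable (Abut a s t) := inferInstanceAs (Decidable (_ ∨ _))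

instance (a s t : ℤ) : Decidable (Overlap a s t) := inferInstanceAs (Decidable (_ ∧ _))

/-- Bricks of dimensions `d` rooted at `p` and `q` have disjoint interiors. -/
def Separated (d p q : ℤ × ℤ × ℤ) : Prop :=
  ¬ Overlap d.1 p.1 q.1 ∨ ¬ Overlap d.2.1 p.2.1 q.2.1 ∨ ¬ Overlap d.2.2 p.2.2 q.2.2

/-- Bricks of dimensions `d` rooted at `p` and `q` share a non-degenerate rectangle. -/
def ShareFace (d p q : ℤ × ℤ × ℤ) : Prop :=
  Abut d.1 p.1 q.1 ∧ Overlap d.2.1 p.2.1 q.2.1 ∧ Overlap d.2.2 p.2.2 q.2.2 ∨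
  Overlap d.1 p.1 q.1 ∧ Abut d.2.1 p.2.1 q.2.1 ∧ Overlap d.2.2 p.2.2 q.2.2 ∨
  Overlap d.1 p.1 q.1 ∧ Overlap d.2.1 p.2.1 q.2.1 ∧ Abut d.2.2 p.2.2 q.2.2

instance (d p q : ℤ × ℤ × ℤ) : Decidable (Separated d p q) := inferInstanceAs (Decidable (_ ∨ _))

instance (d p q : ℤ × ℤ × ℤ) : Decidable (ShareFace d p q) := inferInstanceAs (Decidable (_ ∨ _))

theorem Abut.not_overlap {a s t : ℤ} (h : Abut a s t) : ¬ Overlap a s t := by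
  unfold Abut at h
  unfold Overlap
  omega

theorem overlap_of_mem {a s t : ℤ} {x : ℝ} (hs : s < x) (hs' : x < s + a) (ht : t < x)
    (ht' : x < t + a) : Overlap a s t := by
  constructor
  · exact_mod_cast hs.trans ht'
  · exact_mod_cast ht.trans hs'

theorem Overlap.exists_mem {a s t : ℤ} (h : Overlap a s t) :
    ∃ x : ℝ, (s ≤ x ∧ x ≤ s + a) ∧ (t ≤ x ∧ x ≤ t + a) ∧ ∀ m : ℤ, x ≠ m := by
  have key : ∀ m : ℤ, s ≤ m → m + 1 ≤ s + a → t ≤ m → m + 1 ≤ t + a →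
      ∃ x : ℝ, (s ≤ x ∧ x ≤ s + a) ∧ (t ≤ x ∧ x ≤ t + a) ∧ ∀ m : ℤ, x ≠ m := by
    intro m h₁ h₂ h₃ h₄
    rify at h₁ h₂ h₃ h₄
    refine ⟨m + 1 / 2, ⟨by linarith, by linarith⟩, ⟨by linarith, by linarith⟩, fun k hk => ?_⟩
    have : (2 * m + 1 : ℝ) = 2 * k := by linarith
    have : 2 * m + 1 = 2 * k := by exact_mod_cast this
    omega
  obtain ⟨h₁, h₂⟩ := h
  exact key (max s t) (by omega) (by omega) (by omega) (by omega)

theorem Abut.exists_mem {a s t : ℤ} (h : Abut a s t) (ha : 0 < a) :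
    ∃ x : ℝ, (s ≤ x ∧ x ≤ s + a) ∧ (t ≤ x ∧ x ≤ t + a) := by
  have ha' : (0 : ℝ) < a := by exact_mod_cast ha
  rcases h with h | h
  · have h' : (s + a : ℝ) = t := by exact_mod_cast h
    exact ⟨t, ⟨by linarith, by linarith⟩, ⟨by linarith, by linarith⟩⟩
  · have h' : (t + a : ℝ) = s := by exact_mod_cast h
    exact ⟨s, ⟨by linarith, by linarith⟩, ⟨by linarith, by linarith⟩⟩

theorem Separated.not_collide {d p q : ℤ × ℤ × ℤ} (h : Separated d p q) :
    ¬ Cuboid.Collide ⟨p, d⟩ ⟨q, d⟩ := by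
  rintro ⟨x, ⟨h₁, h₂, h₃, h₄, h₅, h₆⟩, k₁, k₂, k₃, k₄, k₅, k₆⟩
  rcases h with h | h | h
  · exact h (overlap_of_mem h₁ h₂ k₁ k₂)
  · exact h (overlap_of_mem h₃ h₄ k₃ k₄)
  · exact h (overlap_of_mem h₅ h₆ k₅ k₆)

theorem ShareFace.touch {d p q : ℤ × ℤ × ℤ} (h : ShareFace d p q)
    (hd : 0 < d.1 ∧ 0 < d.2.1 ∧ 0 < d.2.2) : Cuboid.Touch ⟨p, d⟩ ⟨q, d⟩ := by
  obtain ⟨hd₁, hd₂, hd₃⟩ := hd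
  rcases h with ⟨hx, hy, hz⟩ | ⟨hx, hy, hz⟩ | ⟨hx, hy, hz⟩
  · refine ⟨Separated.not_collide (.inl hx.not_overlap), ?_⟩
    obtain ⟨x, ⟨x₁, x₂⟩, x₃, x₄⟩ := hx.exists_mem hd₁
    obtain ⟨y, ⟨y₁, y₂⟩, ⟨y₃, y₄⟩, hy⟩ := hy.exists_mem
    obtain ⟨z, ⟨z₁, z₂⟩, ⟨z₃, z₄⟩, hz⟩ := hz.exists_mem
    refine ⟨(x, y, z), ⟨⟨x₁, x₂, y₁, y₂, z₁, z₂⟩, ⟨x₃, x₄, y₃, y₄, z₃, z₄⟩⟩, ?_⟩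
    rintro (⟨-, m, hm⟩ | ⟨-, m, hm⟩ | ⟨⟨m, hm⟩, -⟩)
    exacts [hy m hm, hz m hm, hy m hm]
  · refine ⟨Separated.not_collide (.inr (.inl hy.not_overlap)), ?_⟩
    obtain ⟨x, ⟨x₁, x₂⟩, ⟨x₃, x₄⟩, hx⟩ := hx.exists_mem
    obtain ⟨y, ⟨y₁, y₂⟩, y₃, y₄⟩ := hy.exists_mem hd₂
    obtain ⟨z, ⟨z₁, z₂⟩, ⟨z₃, z₄⟩, hz⟩ := hz.exists_mem
    refine ⟨(x, y, z), ⟨⟨x₁, x₂, y₁, y₂, z₁, z₂⟩, ⟨x₃, x₄, y₃, y₄, z₃, z₄⟩⟩, ?_⟩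
    rintro (⟨⟨m, hm⟩, -⟩ | ⟨⟨m, hm⟩, -⟩ | ⟨-, m, hm⟩)
    exacts [hx m hm, hx m hm, hz m hm]
  · refine ⟨Separated.not_collide (.inr (.inr hz.not_overlap)), ?_⟩
    obtain ⟨x, ⟨x₁, x₂⟩, ⟨x₃, x₄⟩, hx⟩ := hx.exists_mem
    obtain ⟨y, ⟨y₁, y₂⟩, ⟨y₃, y₄⟩, hy⟩ := hy.exists_mem
    obtain ⟨z, ⟨z₁, z₂⟩, z₃, z₄⟩ := hz.exists_mem hd₃
    refine ⟨(x, y, z), ⟨⟨x₁, x₂, y₁, y₂, z₁, z₂⟩, ⟨x₃, x₄, y₃, y₄, z₃, z₄⟩⟩, ?_⟩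
    rintro (⟨⟨m, hm⟩, -⟩ | ⟨⟨m, hm⟩, -⟩ | ⟨⟨m, hm⟩, -⟩)
    exacts [hx m hm, hx m hm, hy m hm]

/-! ### A backtracking search refuting 5-colorings

A graph on the vertices `0, …, n - 1` is given by the list of its adjacency rows, read as bit masks.
A state of the search is a mask whose bit `n * c + v` tells whether the color `c` is still available
at the vertex `v`, together with the mask of the uncolored vertices. -/

/-- Set difference of bit masks. -/
def maskDiff (s t : ℕ) : ℕ := s ^^^ (s &&& t)

/-- The state after coloring `v` with `c`, which removes `c` from the neighbors of `v`. -/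
def assignColor (rows : List ℕ) (n s c v : ℕ) : ℕ := maskDiff s (rows.getD v 0 <<< (n * c))

/-- A vertex of the mask `u` with the fewest available colors. The masks `a₁`, `a₂`, `a₃` collect
the vertices with at least one, two, three available colors among those already inspected; the
colors below the last argument are still to be inspected. -/
def scarcestVertex (n s u : ℕ) (a₁ a₂ a₃ : ℕ) : ℕ → ℕ
  | 0 =>
    if maskDiff u a₁ ≠ 0 then (maskDiff u a₁).log2
    else if maskDiff u a₂ ≠ 0 then (maskDiff u a₂).log2
    else if maskDiff u a₃ ≠ 0 then (maskDiff u a₃).log2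
    else u.log2
  | k + 1 =>
    let m := s >>> (n * k)
    scarcestVertex n s u (a₁ ||| m) (a₂ ||| (a₁ &&& m)) (a₃ ||| (a₂ &&& m)) k

/-- Backtracking search branching at a vertex with the fewest available colors; `true` means that
no 5-coloring is compatible with the state. -/
def refutes (rows : List ℕ) (n : ℕ) : ℕ → ℕ → ℕ → Bool
  | 0, _, _ => false
  | fuel + 1, s, u =>
    let v := scarcestVertex n s u 0 0 0 5
    Nat.blt v n && (List.range 5).all fun c =>
      !s.testBit (n * c + v) ||
        refutes rows n fuel (assignColor rows n s c v) (maskDiff u (2 ^ v))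

/-- The mask of available colors after the vertices `0, 1, 2, 3` received the colors
`0, 1, 2, 3`. -/
def initialState (rows : List ℕ) (n : ℕ) : ℕ :=
  (List.range 4).foldl (fun s i => assignColor rows n s i i) (2 ^ (5 * n) - 1)

/-- Every vertex has its color under `κ` still available in the state `s`. -/
def Compatible (n : ℕ) (κ : ℕ → Fin 5) (s : ℕ) : Prop :=
  ∀ v < n, s.testBit (n * (κ v : ℕ) + v) = true

/-- `κ` is a proper coloring of the graph with adjacency masks `rows`. -/
def ProperOn (rows : List ℕ) (n : ℕ) (κ : ℕ → Fin 5) : Prop :=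
  ∀ v < n, ∀ w < n, (rows.getD v 0).testBit w = true → κ v ≠ κ w

section Search

variable {rows : List ℕ} {n : ℕ} {κ : ℕ → Fin 5}

theorem testBit_maskDiff (s t i : ℕ) :
    (maskDiff s t).testBit i = (s.testBit i && !t.testBit i) := by
  simp only [maskDiff, Nat.testBit_xor, Nat.testBit_and]
  cases s.testBit i <;> cases t.testBit i <;> rfl

theorem Compatible.assignColor {s v : ℕ} (hs : Compatible n κ s) (hκ : ProperOn rows n κ)
    (hrows : ∀ r ∈ rows, r < 2 ^ n) (hv : v < n) :
    Compatible n κ (assignColor rows n s (κ v) v) := by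
  intro w hw
  rw [_root_.assignColor, testBit_maskDiff, hs w hw, Bool.true_and, Bool.not_eq_true',
    Nat.testBit_shiftLeft, Bool.and_eq_false_iff, decide_eq_false_iff_not]
  rcases lt_trichotomy (κ w : ℕ) (κ v) with h | h | h
  · have : n * (κ w : ℕ) + n ≤ n * (κ v : ℕ) := by
      rw [← Nat.mul_succ]
      exact Nat.mul_le_mul_left n h
    omega
  · right
    rw [h, Nat.add_sub_cancel_left]
    by_contra hvw
    exact hκ v hv w hw (by simpa using hvw) (Fin.ext h.symm)
  · right
    have hle : n * (κ v : ℕ) + n ≤ n * (κ w : ℕ) := by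
      rw [← Nat.mul_succ]
      exact Nat.mul_le_mul_left n h
    have hrow : rows.getD v 0 < 2 ^ n := by
      rcases lt_or_ge v rows.length with hl | hl
      · rw [List.getD_eq_getElem _ _ hl]
        exact hrows _ (List.getElem_mem hl)
      · rw [List.getD_eq_default _ _ hl]
        positivity
    exact Nat.testBit_lt_two_pow (hrow.trans_le (Nat.pow_le_pow_right two_pos (by omega)))

theorem not_compatible_of_refutes (hκ : ProperOn rows n κ) (hrows : ∀ r ∈ rows, r < 2 ^ n)
    (fuel s u : ℕ) (h : refutes rows n fuel s u = true) : ¬ Compatible n κ s := by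
  induction fuel generalizing s u with
  | zero => simp [refutes] at h
  | succ fuel ih =>
    intro hs
    simp only [refutes, Bool.and_eq_true, List.all_eq_true, List.mem_range, Bool.or_eq_true,
      Bool.not_eq_true', Nat.blt_eq] at h
    obtain ⟨hv, h⟩ := h
    rcases h _ (κ (scarcestVertex n s u 0 0 0 5)).isLt with h | h
    · rw [hs _ hv] at h
      exact absurd h (by decide)
    · exact ih _ _ h (hs.assignColor hκ hrows hv)

theorem compatible_initialState (hκ : ProperOn rows n κ) (hrows : ∀ r ∈ rows, r < 2 ^ n)
    (hn : 4 ≤ n) (hκ₄ : ∀ i < 4, (κ i : ℕ) = i) : Compatible n κ (initialState rows n) := by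
  have hfull : Compatible n κ (2 ^ (5 * n) - 1) := by
    intro v hv
    rw [Nat.testBit_two_pow_sub_one, decide_eq_true_iff]
    have : n * (κ v : ℕ) ≤ n * 4 := Nat.mul_le_mul_left n (Nat.le_of_lt_succ (κ v).isLt)
    omega
  have hstep : ∀ m ≤ 4, Compatible n κ
      ((List.range m).foldl (fun s i => assignColor rows n s i i) (2 ^ (5 * n) - 1)) := by
    intro m
    induction m with
    | zero => exact fun _ => hfull
    | succ m ih =>
      intro hm
      rw [List.range_succ, List.foldl_append]
      have := (ih (by omega)).assignColor hκ hrows (v := m) (by omega)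
      rwa [hκ₄ m hm] at this
  exact hstep 4 le_rfl

theorem exists_perm_normalizing (f : ℕ → Fin 5) (hf : ∀ i < 4, ∀ j < i, f i ≠ f j) :
    ∃ σ : Equiv.Perm (Fin 5), ∀ i < 4, (σ (f i) : ℕ) = i := by
  have hinj : Function.Injective fun i : Fin 4 => f i := by
    intro i j hij
    rcases lt_trichotomy i j with h | h | h
    · exact absurd hij.symm (hf j j.isLt i h)
    · exact h
    · exact absurd hij (hf i i.isLt j h)
  have := Equiv.Perm.isMultiplyPretransitive (Fin 5) 4
  obtain ⟨σ, hσ⟩ := MulAction.exists_smul_eq (Equiv.Perm (Fin 5))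
    (⟨fun i : Fin 4 => f i, hinj⟩ : Fin 4 ↪ Fin 5) Fin.castSuccEmb
  refine ⟨σ, fun i hi => ?_⟩
  have := congrArg Fin.val (DFunLike.congr_fun hσ ⟨i, hi⟩)
  simpa using this

theorem not_properOn_of_refutes {fuel : ℕ} (hn : 4 ≤ n) (hrows : ∀ r ∈ rows, r < 2 ^ n)
    (hclique : ∀ i < 4, ∀ j < i, (rows.getD i 0).testBit j = true)
    (h : refutes rows n fuel (initialState rows n) (2 ^ n - 2 ^ 4) = true) :
    ¬ ProperOn rows n κ := by
  intro hκ
  obtain ⟨σ, hσ⟩ := exists_perm_normalizing κ fun i hi j hj =>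
    hκ i (by omega) j (by omega) (hclique i hi j hj)
  have hσκ : ProperOn rows n fun v => σ (κ v) :=
    fun v hv w hw hvw heq => hκ v hv w hw hvw (σ.injective heq)
  exact not_compatible_of_refutes hσκ hrows fuel _ _ h
    (compatible_initialState hσκ hrows hn hσ)

end Search

/-! ### From brick lists to configurations -/

/-- The configuration of bricks with dimensions `d` and the given roots. -/
def bricks (d : ℤ × ℤ × ℤ) (roots : List (ℤ × ℤ × ℤ)) : Finset Cuboid :=
  (roots.map fun p => ⟨p, d⟩).toFinset

theorem mem_bricks {d : ℤ × ℤ × ℤ} {roots : List (ℤ × ℤ × ℤ)} {C : Cuboid} :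
    C ∈ bricks d roots ↔ ∃ p ∈ roots, ⟨p, d⟩ = C := by
  simp [bricks]

theorem exists_not_properColoring (a b c : ℕ) (habc : 0 < a ∧ 0 < b ∧ 0 < c)
    (roots : List (ℤ × ℤ × ℤ)) (rows : List ℕ) (hlen : 4 ≤ roots.length)
    (hsep : roots.Pairwise (Separated (a, b, c)))
    (hface : ∀ i < roots.length, ∀ j < roots.length, (rows.getD i 0).testBit j = true →
      ShareFace (a, b, c) (roots.getD i 0) (roots.getD j 0))
    (hrows : ∀ r ∈ rows, r < 2 ^ roots.length)
    (hclique : ∀ i < 4, ∀ j < i, (rows.getD i 0).testBit j = true)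
    (hrefutes : refutes rows roots.length roots.length (initialState rows roots.length)
      (2 ^ roots.length - 2 ^ 4) = true) :
    ∃ F : Finset Cuboid, IsConfig F ∧ Type1 a b c F ∧ ¬ ProperColoring 5 F := by
  have hpos : 0 < (a : ℤ) ∧ 0 < (b : ℤ) ∧ 0 < (c : ℤ) := by exact_mod_cast habc
  refine ⟨bricks (a, b, c) roots, ⟨?_, ?_⟩, ?_, ?_⟩
  · intro C hC
    obtain ⟨p, -, rfl⟩ := mem_bricks.1 hC
    exact hpos
  · intro C hC D hD hCD
    obtain ⟨p, hp, rfl⟩ := mem_bricks.1 hC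
    obtain ⟨q, hq, rfl⟩ := mem_bricks.1 hD
    have hsymm : ∀ p q, Separated (a, b, c) p q → Separated (a, b, c) q p := by
      intro p q h
      simpa only [Separated, Overlap, and_comm] using h
    have : Std.Symm (Separated (a, b, c)) := ⟨hsymm⟩
    exact (hsep.forall hp hq fun h => hCD (by rw [h])).not_collide
  · intro C hC
    obtain ⟨p, -, rfl⟩ := mem_bricks.1 hC
    rfl
  · rintro ⟨κ, hκ⟩
    have hmem : ∀ i < roots.length, (⟨roots.getD i 0, (a, b, c)⟩ : Cuboid) ∈
        bricks (a, b, c) roots := by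
      intro i hi
      rw [List.getD_eq_getElem _ _ hi]
      exact mem_bricks.2 ⟨_, List.getElem_mem hi, rfl⟩
    exact not_properOn_of_refutes (κ := fun i => κ ⟨roots.getD i 0, (a, b, c)⟩)
      hlen hrows hclique hrefutes fun i hi j hj hij =>
        hκ _ (hmem i hi) _ (hmem j hj) ((hface i hi j hj hij).touch hpos)

/-! ### The configurations -/

/-- Roots of the bricks of a configuration of `[5,2,1]` without a proper 5-coloring. -/
def roots521 : List (ℤ × ℤ × ℤ) :=
  [(7, 3, 2), (4, 1, 2), (3, 2, 1), (8, 2, 1), (8, 3, 4), (13, 7, 0), (16, 1, 4), (14, 6, 1),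
   (10, 1, 6), (10, 5, 2), (7, 7, 4), (13, 7, 2), (10, 8, 1), (13, 5, 4), (15, 8, 3), (10, 0, 1),
   (14, 3, 4), (8, 5, 4), (9, 8, 5), (14, 1, 2), (14, 8, 5), (16, 4, 1), (13, 2, 1), (16, 8, 1),
   (12, 4, 7), (15, 7, 6), (9, 1, 0), (7, 7, 2), (2, 5, 0), (15, 1, 6), (8, 5, 6), (9, 6, 1),
   (13, 0, 3), (1, 4, 1), (17, 2, 5), (19, 3, 4), (10, 8, 3), (6, 6, 3), (4, 4, 3), (5, 0, 1),
   (14, 4, 3), (5, 3, 0), (7, 5, 0), (18, 7, 0), (14, 6, 7), (9, 4, 3), (16, 6, 3), (2, 3, 2),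
   (19, 6, 1), (5, 2, 3), (11, 6, 5), (14, 2, 7), (18, 5, 4), (18, 5, 6), (16, 2, 3), (4, 6, 1),
   (12, 2, 5), (13, 5, 6), (20, 4, 5), (11, 3, 6), (11, 4, 1), (15, 3, 0), (11, 6, 3),
   (11, 1, 4), (15, 4, 5), (10, 7, 6), (0, 5, 2), (10, 2, 3), (12, 3, 2), (9, 6, 7), (14, 0, 5),
   (17, 5, 0), (16, 6, 5), (6, 4, 1), (9, 1, 2), (17, 3, 2), (16, 3, 6), (12, 5, 0), (12, 7, 4),
   (15, 5, 2), (20, 5, 2), (10, 3, 0), (19, 4, 3), (5, 5, 2)]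

/-- Bit `j` of entry `i` tells whether the bricks `i` and `j` of `roots521` touch. -/
def contacts521 : List ℕ :=
  [9700184631332671596790286, 18889466635715778445325, 9444733109234147786763,
   2446482138955909030772743, 156869980629772664832, 153476910702061718343808,
   1189905064802648129536, 757940973712355891354144, 1181242390864103211008,
   10285615112239213266864257, 302236067715781786730496, 604467521563772634288768, 2281703584,
   306976885552771238133760, 302236066660113184720896, 18889465932028408496136,
   175338645443466764352, 302236067751172316865552, 302268349517704620672000,
   57111137666607580479488, 306990716000574298652672, 2004943178929332547485824,
   2474818643693387335106568, 290271069735072, 76148882381606481821696, 4759414236896488849408,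
   2417851639232007132708872, 9671411204632057149919744, 9444769001141969092608,
   76739106116795069628672, 627911000346427654144, 9831968206289301141461664,
   19046281270503622049856, 9680925113030801325293572, 76757262378710530588736,
   4835722035950981876875328, 302236066589813294255104, 9671411168638579928860160,
   9671480344632337488805905, 18889465931478647996430, 5478392476296127157707264,
   2427296372199404611829772, 2578413288599329351663616, 2361183522909807706272,
   627342420893505683456, 9671853891025282636325393, 6951328078974835320973312,
   9680925077422300947546119, 1815749912672174688174208, 19037040060264995618835,
   307009305733937252148224, 75558440186667180491008, 4840444379987338820919296,
   80299109316014125350912, 4873777358227791380283456, 9680925076863476712865792,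
   76766701923512319279440, 80926452862808578064384, 80298690463708099903488,
   75576528894571587830016, 3183172463206729640837769, 2571329702844026431995904,
   906694364817830801731072, 1328237630905420677200, 80281325709444866187264,
   590441069039983001600, 9671406593086851372810240, 19193837807932921151505,
   661280052526527013192201, 37037620928771522560, 9295429648609444160, 151118033585108932362400,
   302250348629994054361088, 12089259385243938936848909, 442722421273038192651,
   6649387173801137841635328, 19538867001080414208, 2420216281239607188652192,
   4726979365225444566016, 6082708942801748656917120, 5477945120480632170872832,
   160563919188678898876424, 1851167683874401676165120, 9518556147176196538881]

/-- Roots of the bricks of a configuration of `[4,3,1]` without a proper 5-coloring. -/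
def roots431 : List (ℤ × ℤ × ℤ) :=
  [(8, 5, 2), (5, 3, 1), (4, 4, 2), (8, 2, 2), (12, 5, 4), (6, 0, 3), (0, 5, 2), (10, 8, 4),
   (1, 6, 3), (5, 2, 4), (4, 10, 2), (4, 5, 4), (8, 2, 0), (11, 6, 1), (7, 4, 5), (11, 3, 3),
   (10, 0, 3), (5, 9, 3), (9, 3, 1), (7, 0, 1), (4, 8, 0), (3, 6, 1), (7, 7, 5), (1, 3, 1),
   (6, 5, 0), (8, 8, 0), (2, 8, 4), (9, 9, 3), (13, 7, 3), (1, 9, 3), (3, 3, 3), (9, 9, 1),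
   (8, 11, 2), (12, 1, 2), (12, 4, 2), (3, 0, 1), (9, 6, 3), (7, 11, 4), (5, 9, 1), (8, 5, 4),
   (6, 8, 4), (9, 2, 4), (4, 1, 2), (12, 7, 2), (3, 11, 4), (7, 6, 1), (8, 8, 2), (4, 2, 0),
   (7, 3, 3), (4, 7, 2), (5, 6, 3)]

/-- Bit `j` of entry `i` tells whether the bricks `i` and `j` of `roots431` touch. -/
def contacts431 : List ℕ :=
  [2084759945912334, 180354294747149, 2009908339802443, 285898793910311, 2817767014528,
   288073120285192, 562951037649156, 1855832719376, 1688851537987652, 284224829540384,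
   633598407475200, 1409025296057088, 140737505918978, 114368570458113, 2748783266304,
   284318245126169, 283682589933608, 1778052774233088, 35210159206411, 145169894871050,
   35459302424576, 598409229631558, 1649267460224, 145169896702022, 175921897410562,
   35461415313408, 1144592141519104, 80475070791808, 8864946716816, 580542206706944,
   1411772930067300, 114628415725568, 70645903918080, 17180229640, 8873402736649,
   145135543779330, 1488206570750097, 18691832021120, 668509548839936, 1410742142159504,
   1144248212785280, 282024732639792, 281510419103790, 70457193668609, 1237554692096,
   633595776737287, 1733180499567617, 34385432578, 1133116525742637, 1231728440116549,
   916512802212101]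

/-- Roots of the bricks of a configuration of `[2,2,2]` without a proper 5-coloring. -/
def roots222 : List (ℤ × ℤ × ℤ) :=
  [(6, 5, 2), (5, 5, 0), (4, 6, 2), (4, 4, 2), (8, 2, 6), (1, 1, 4), (9, 5, 4), (4, 0, 2),
   (7, 1, 4), (4, 3, 0), (6, 7, 1), (5, 1, 4), (1, 5, 3), (5, 9, 4), (6, 3, 1), (4, 2, 2),
   (6, 9, 2), (8, 8, 6), (6, 3, 7), (2, 1, 2), (1, 5, 5), (4, 3, 4), (7, 5, 0), (4, 4, 6),
   (8, 7, 4), (2, 7, 5), (6, 9, 6), (4, 7, 4), (3, 5, 4), (8, 4, 2), (2, 3, 1), (7, 5, 4),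
   (4, 8, 2), (5, 5, 4), (2, 3, 5), (6, 3, 5), (3, 9, 4), (6, 7, 5), (8, 6, 6), (8, 4, 6),
   (4, 6, 6), (2, 7, 3), (8, 6, 2), (3, 1, 4), (6, 1, 6), (6, 3, 3), (7, 9, 4), (3, 1, 0),
   (8, 3, 4), (2, 3, 3), (6, 7, 3), (6, 1, 2), (0, 3, 4), (4, 2, 6), (4, 8, 6), (6, 5, 6),
   (6, 7, 7)]

/-- Bit `j` of entry `i` tells whether the bricks `i` and `j` of `roots222` touch. -/
def contacts222 : List ℕ :=
  [1165493603943438, 4212237, 1128112217654283, 598144259768839, 299651278569728,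
   5075362854207488, 286700358074368, 2401333395621888, 2586085708269584, 140738562146314,
   1130302252580871, 11320606081450368, 5068748873531392, 19210877815291904, 2286984726872587,
   2999468796955272, 1196272945996800, 72128375182852096, 45054172583690256, 712484608573600,
   4503617109233664, 9614190079674376, 4398583399427, 45037156185669632, 1201081162006592,
   18017766167543808, 90142498730680320, 19143816296538116, 566274437419020, 321059547004993,
   703687442334216, 37476759897112641, 1128167783867396, 37191155168837645, 14082545208524832,
   45370808312531216, 18016601995485184, 127298443562590208, 108087080416051264,
   36310583381065808, 126100936039858176, 73450655748, 1125902612169793, 9570166390687904,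
   9007233614743824, 2533320426572041, 1126037429886976, 1074299520, 35771171995984,
   4512414245097512, 74919413097477, 35184372140416, 562967134343200, 26439829424128,
   72058899942875136, 72059700728037376, 54044707424174080]


/-- For each of `(5,2,1)`, `(4,3,1)` and `(2,2,2)` there is a type-1 configuration
with no proper 5-coloring. -/
theorem exists_type1_not_5colorable :
    (∃ F : Finset Cuboid, IsConfig F ∧ Type1 5 2 1 F ∧ ¬ ProperColoring 5 F) ∧
    (∃ F : Finset Cuboid, IsConfig F ∧ Type1 4 3 1 F ∧ ¬ ProperColoring 5 F) ∧
    (∃ F : Finset Cuboid, IsConfig F ∧ Type1 2 2 2 F ∧ ¬ ProperColoring 5 F) := by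
  refine ⟨?_, ?_, ?_⟩
  · exact exists_not_properColoring 5 2 1 (by decide) roots521 contacts521 (by decide +kernel)
      (by decide +kernel) (by decide +kernel) (by decide +kernel) (by decide +kernel)
      (by decide +kernel)
  · exact exists_not_properColoring 4 3 1 (by decide) roots431 contacts431 (by decide +kernel)
      (by decide +kernel) (by decide +kernel) (by decide +kernel) (by decide +kernel)
      (by decide +kernel)
  · exact exists_not_properColoring 2 2 2 (by decide) roots222 contacts222 (by decide +kernel)
      (by decide +kernel) (by decide +kernel) (by decide +kernel) (by decide +kernel)
      (by decide +kernel)
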